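/- arXiv:2005.13861 — 2 statements merged into one kernel-verified Lean document; each statement's English description precedes it below -/
import Mathlib

section
/- Let C be a triangulated category equipped with a cotorsion pair (S,V) such that K := add(S*V) is functorially finite in C. Then for every object X of C there exists a distinguished triangle X →ι K̃ → K' → X[1] such that K̃ and K' belong to K and ι : X → K̃ is a left K-approximation of X (every morphism from X to an object of K factors through ι). -/
universe w v u v₂ u₂

open CategoryTheory Category Limits Pretriangulated

namespace PaperFormalization

variable (C : Type u) [Category.{v} C] [Preadditive C] [HasZeroObject C]
  [HasShift C ℤ] [∀ n : ℤ, (shiftFunctor C n).Additive] [Pretriangulated C]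
  [IsTriangulated C] [HasBinaryBiproducts C]

/-- `X` is a direct summand of `Z`. -/
def IsSummandOf (X Z : C) : Prop := ∃ (i : X ⟶ Z) (p : Z ⟶ X), i ≫ p = 𝟙 X

/-- The morphism `f` factors through some object of `A`. -/
def FactorsThruSet (A : Set C) {X Y : C} (f : X ⟶ Y) : Prop :=
  ∃ Z ∈ A, ∃ (a : X ⟶ Z) (b : Z ⟶ Y), a ≫ b = f

/-- A cotorsion pair `(S, V)` supported on the (triangulated) subcategory determined by
`N ⊆ C`: both classes are contained in `N`, each is closed under isomorphisms, finite
direct sums and direct summands, `Hom(S, V⟦1⟧) = 0`, and every object of `N` admits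
distinguished triangles `V' → S' → X → V'⟦1⟧` and `X → V' → S' → X⟦1⟧` with `S' ∈ S`,
`V' ∈ V`. -/
structure IsTriCotorsionPairOn (N S V : Set C) : Prop where
  S_sub : S ⊆ N
  V_sub : V ⊆ N
  S_iso : ∀ {X Y : C}, (X ≅ Y) → X ∈ S → Y ∈ S
  S_sum : ∀ {X Y : C}, X ∈ S → Y ∈ S → (X ⊞ Y) ∈ S
  S_summand : ∀ {X Z : C}, Z ∈ S → IsSummandOf C X Z → X ∈ S
  V_iso : ∀ {X Y : C}, (X ≅ Y) → X ∈ V → Y ∈ V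
  V_sum : ∀ {X Y : C}, X ∈ V → Y ∈ V → (X ⊞ Y) ∈ V
  V_summand : ∀ {X Z : C}, Z ∈ V → IsSummandOf C X Z → X ∈ V
  orth : ∀ {A B : C}, A ∈ S → B ∈ V → ∀ f : A ⟶ (B⟦(1 : ℤ)⟧), f = 0
  resolve : ∀ X ∈ N, ∃ (Vx Sx : C), Vx ∈ V ∧ Sx ∈ S ∧
    ∃ (f : Vx ⟶ Sx) (g : Sx ⟶ X) (h : X ⟶ (Vx⟦(1 : ℤ)⟧)),
      Triangle.mk f g h ∈ distTriang C
  coresolve : ∀ X ∈ N, ∃ (Vx Sx : C), Vx ∈ V ∧ Sx ∈ S ∧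
    ∃ (f : X ⟶ Vx) (g : Vx ⟶ Sx) (h : Sx ⟶ (X⟦(1 : ℤ)⟧)),
      Triangle.mk f g h ∈ distTriang C

/-- A cotorsion pair `(S, V)` on the triangulated category `C` itself. -/
abbrev IsTriCotorsionPair (S V : Set C) : Prop := IsTriCotorsionPairOn C Set.univ S V

/-- The class `S * V` of objects `Y` admitting a distinguished triangle
`S → Y → V → S⟦1⟧` with `S ∈ S`, `V ∈ V`. -/
def SstarV (S V : Set C) : Set C :=
  {Y | ∃ (S' V' : C), S' ∈ S ∧ V' ∈ V ∧
    ∃ (f : S' ⟶ Y) (g : Y ⟶ V') (h : V' ⟶ (S'⟦(1 : ℤ)⟧)),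
      Triangle.mk f g h ∈ distTriang C}

/-- Membership in the additive closure of `A`: closure of `A` under isomorphisms,
finite direct sums and direct summands. -/
inductive addMem (A : Set C) : C → Prop
  | of {X : C} : X ∈ A → addMem A X
  | iso {X Y : C} : (X ≅ Y) → addMem A X → addMem A Y
  | sum {X Y : C} : addMem A X → addMem A Y → addMem A (X ⊞ Y)
  | summand {X Z : C} : addMem A Z → IsSummandOf C X Z → addMem A X

/-- `K := add (S * V)`. -/
def Kcl (S V : Set C) : Set C := {X | addMem C (SstarV C S V) X}

/-- `A` is functorially finite: every object has a left `A`-approximation and a right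
`A`-approximation. -/
def FunctoriallyFinite (A : Set C) : Prop :=
  (∀ X : C, ∃ K ∈ A, ∃ ι : X ⟶ K, ∀ K' ∈ A, ∀ f : X ⟶ K', ∃ t : K ⟶ K', ι ≫ t = f) ∧
  (∀ X : C, ∃ K ∈ A, ∃ p : K ⟶ X, ∀ K' ∈ A, ∀ f : K' ⟶ X, ∃ t : K' ⟶ K, t ≫ p = f)

/-- The ideal-quotient relation on `C` modulo morphisms factoring through `K`;
the corresponding quotient category is the additive quotient `C/K`. -/
def Krel (S V : Set C) : HomRel C :=
  fun {X Y} f g => FactorsThruSet C (Kcl C S V) (f - g)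

/-- The additive quotient `C/K`. -/
abbrev KQuot (S V : Set C) := CategoryTheory.Quotient (Krel C S V)

/-- The additive quotient functor `ϖ : C ⥤ C/K`. -/
abbrev Kproj (S V : Set C) : C ⥤ KQuot C S V :=
  CategoryTheory.Quotient.functor (Krel C S V)

variable {C}

open scoped ZeroObject

/-- In a cotorsion pair, `V` contains every object `Y` with `Hom(S, Y⟦1⟧) = 0`. -/
lemma IsTriCotorsionPairOn.mem_right_of_orth {S V : Set C} (hP : IsTriCotorsionPair C S V)
    {Y : C} (hY : ∀ A ∈ S, ∀ f : A ⟶ Y⟦(1 : ℤ)⟧, f = 0) : Y ∈ V := by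
  obtain ⟨V', S', hV', hS', f, g, h, hT⟩ := hP.coresolve Y (Set.mem_univ Y)
  have : Mono f := Triangle.mono₁ _ hT (hY S' hS' h)
  have : IsSplitMono f := isSplitMono_of_mono f
  exact hP.V_summand hV' ⟨f, retraction f, IsSplitMono.id f⟩

/-- In a cotorsion pair, `V` is closed under extensions. -/
lemma IsTriCotorsionPairOn.right_mem_of_triangle {S V : Set C} (hP : IsTriCotorsionPair C S V)
    {T : Triangle C} (hT : T ∈ distTriang C) (h₁ : T.obj₁ ∈ V) (h₃ : T.obj₃ ∈ V) :
    T.obj₂ ∈ V := by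
  refine hP.mem_right_of_orth fun A hA f ↦ ?_
  obtain ⟨k, hk⟩ := Triangle.coyoneda_exact₂ _ (Triangle.shift_distinguished _ hT 1) f
    (hP.orth hA h₃ _)
  exact hk.trans ((congrArg (· ≫ _) (hP.orth hA h₁ k)).trans zero_comp)

lemma IsTriCotorsionPairOn.zero_mem_left {S V : Set C} (hP : IsTriCotorsionPair C S V) :
    (0 : C) ∈ S := by
  obtain ⟨-, S', -, hS', -⟩ := hP.resolve 0 (Set.mem_univ _)
  exact hP.S_summand hS' ⟨0, 0, (isZero_zero C).eq_of_src _ _⟩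

lemma IsTriCotorsionPairOn.right_subset_Kcl {S V : Set C} (hP : IsTriCotorsionPair C S V) :
    V ⊆ Kcl C S V := fun Y hY ↦
  .of ⟨0, Y, hP.zero_mem_left, hY, 0, 𝟙 Y, 0, contractible_distinguished₁ Y⟩

/-- Every morphism from an object of `add (S * V)` to an object of `V⟦1⟧` factors through `V`. -/
lemma IsTriCotorsionPairOn.factorsThru_of_mem_Kcl {S V : Set C} (hP : IsTriCotorsionPair C S V)
    {Y : C} (hY : Y ∈ Kcl C S V) {V₁ : C} (hV₁ : V₁ ∈ V) (f : Y ⟶ V₁⟦(1 : ℤ)⟧) :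
    FactorsThruSet C V f := by
  change addMem C (SstarV C S V) Y at hY
  induction hY with
  | of hY =>
    obtain ⟨S', V', hS', hV', a, b, c, hT⟩ := hY
    obtain ⟨k, hk⟩ := Triangle.yoneda_exact₂ _ hT f (hP.orth hS' hV₁ _)
    exact ⟨V', hV', b, k, hk.symm⟩
  | iso e _ ih =>
    obtain ⟨Z, hZ, a, b, hab⟩ := ih (e.hom ≫ f)
    exact ⟨Z, hZ, e.inv ≫ a, b, by simp [hab]⟩
  | sum _ _ ih₁ ih₂ =>
    obtain ⟨Z₁, hZ₁, a₁, b₁, h₁⟩ := ih₁ (biprod.inl ≫ f)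
    obtain ⟨Z₂, hZ₂, a₂, b₂, h₂⟩ := ih₂ (biprod.inr ≫ f)
    exact ⟨Z₁ ⊞ Z₂, hP.V_sum hZ₁ hZ₂, biprod.map a₁ a₂, biprod.desc b₁ b₂,
      by ext <;> simp [h₁, h₂]⟩
  | summand _ hs ih =>
    obtain ⟨i, p, hip⟩ := hs
    obtain ⟨Z, hZ, a, b, hab⟩ := ih (p ≫ f)
    exact ⟨Z, hZ, i ≫ a, b, by rw [assoc, hab, reassoc_of% hip]⟩

/-- An object all of whose morphisms to `V⟦1⟧` factor through `V` lies in `add (S * V)`. -/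
lemma IsTriCotorsionPairOn.mem_Kcl_of_factorsThru {S V : Set C} (hP : IsTriCotorsionPair C S V)
    {Z : C} (hZ : ∀ V₁ ∈ V, ∀ f : Z ⟶ V₁⟦(1 : ℤ)⟧, FactorsThruSet C V f) : Z ∈ Kcl C S V := by
  obtain ⟨V₁, S₁, hV₁, hS₁, a, g, f, hT⟩ := hP.resolve Z (Set.mem_univ Z)
  obtain ⟨V₀, hV₀, w, v, hwv⟩ := hZ V₁ hV₁ f
  have hT' := rot_of_distTriang _ hT
  obtain ⟨P, s, p, hTP⟩ := distinguished_cocone_triangle₂ (v ≫ (-a⟦(1 : ℤ)⟧'))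
  obtain ⟨r, hsr, hpr⟩ : ∃ r : P ⟶ Z, s ≫ r = 𝟙 S₁ ≫ g ∧ p ≫ v = r ≫ f :=
    complete_distinguished_triangle_morphism₂ _ _ hTP hT' (𝟙 S₁) v
      (show (v ≫ (-a⟦(1 : ℤ)⟧')) ≫ (𝟙 S₁)⟦(1 : ℤ)⟧' = v ≫ (-a⟦(1 : ℤ)⟧') by
        rw [CategoryTheory.Functor.map_id, comp_id])
  have hfa : f ≫ (-a⟦(1 : ℤ)⟧') = 0 := comp_distTriang_mor_zero₂₃ _ hT'
  obtain ⟨w', hw'⟩ : ∃ w' : Z ⟶ P, w = w' ≫ p := Triangle.coyoneda_exact₃ _ hTP w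
    (show w ≫ v ≫ (-a⟦(1 : ℤ)⟧') = 0 by rw [reassoc_of% hwv, hfa])
  obtain ⟨m, hm⟩ : ∃ m : Z ⟶ S₁, w' ≫ r - 𝟙 Z = m ≫ g :=
    Triangle.coyoneda_exact₃ _ hT (w' ≫ r - 𝟙 Z) (show (w' ≫ r - 𝟙 Z) ≫ f = 0 by
      rw [Preadditive.sub_comp, assoc, ← hpr, ← assoc, ← hw', hwv, id_comp, sub_self])
  refine .summand (.of ⟨S₁, V₀, hS₁, hV₀, s, p, _, hTP⟩) ⟨w' - m ≫ s, r, ?_⟩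
  rw [Preadditive.sub_comp, assoc, hsr, id_comp, ← hm, sub_sub_cancel]

/-- The cone of a left `add (S * V)`-approximation lies in `add (S * V)`. -/
lemma IsTriCotorsionPairOn.cone_mem_Kcl {S V : Set C} (hP : IsTriCotorsionPair C S V)
    {X K Z : C} (hK : K ∈ Kcl C S V) {ι : X ⟶ K} {q : K ⟶ Z} {h : Z ⟶ X⟦(1 : ℤ)⟧}
    (hT : Triangle.mk ι q h ∈ distTriang C)
    (hι : ∀ L ∈ Kcl C S V, ∀ f : X ⟶ L, ∃ t : K ⟶ L, ι ≫ t = f) : Z ∈ Kcl C S V := by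
  refine hP.mem_Kcl_of_factorsThru fun V₁ hV₁ f ↦ ?_
  obtain ⟨V₀, hV₀, u, v, huv⟩ := hP.factorsThru_of_mem_Kcl hK hV₁ (q ≫ f)
  obtain ⟨E, i, e, hTE⟩ := distinguished_cocone_triangle₂ v
  have hev : e ≫ v = 0 := comp_distTriang_mor_zero₂₃ _ hTE
  have hιq : ι ≫ q = 0 := comp_distTriang_mor_zero₁₂ _ hT
  have hhι : h ≫ ι⟦(1 : ℤ)⟧' = 0 := comp_distTriang_mor_zero₃₁ _ hT
  obtain ⟨x, hx⟩ : ∃ x : X ⟶ E, ι ≫ u = x ≫ e := Triangle.coyoneda_exact₃ _ hTE (ι ≫ u)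
    (show (ι ≫ u) ≫ v = 0 by rw [assoc, huv, reassoc_of% hιq, zero_comp])
  obtain ⟨t, ht⟩ := hι E (hP.right_subset_Kcl (hP.right_mem_of_triangle hTE hV₁ hV₀)) x
  obtain ⟨w, hw⟩ : ∃ w : Z ⟶ V₀, u - t ≫ e = q ≫ w := Triangle.yoneda_exact₂ _ hT (u - t ≫ e)
    (show ι ≫ (u - t ≫ e) = 0 by
      rw [Preadditive.comp_sub, reassoc_of% ht, hx, sub_self])
  obtain ⟨y, hy⟩ : ∃ y : X⟦(1 : ℤ)⟧ ⟶ V₁⟦(1 : ℤ)⟧, f - w ≫ v = h ≫ y := Triangle.yoneda_exact₃ _ hT (f - w ≫ v)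
    (show q ≫ (f - w ≫ v) = 0 by
      rw [Preadditive.comp_sub, ← huv, ← assoc q, ← hw, Preadditive.sub_comp, assoc t, hev,
        comp_zero, sub_zero, sub_self])
  obtain ⟨y, rfl⟩ := (shiftFunctor C (1 : ℤ)).map_surjective y
  obtain ⟨y, rfl⟩ := hι V₁ (hP.right_subset_Kcl hV₁) y
  rw [Functor.map_comp, reassoc_of% hhι, zero_comp, sub_eq_zero] at hy
  exact ⟨V₀, hV₀, w, v, hy.symm⟩

variable (C)

/-- If `K = add (S * V)` is functorially finite, then every object `X`
fits into a distinguished triangle `X →ι K̃ → K' → X⟦1⟧` with `K̃, K' ∈ K` and `ι` a left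
`K`-approximation of `X`. -/
theorem statement14 (S V : Set C) (hP : IsTriCotorsionPair C S V)
    (hff : FunctoriallyFinite C (Kcl C S V)) (X : C) :
    ∃ (K₁ K₂ : C), K₁ ∈ Kcl C S V ∧ K₂ ∈ Kcl C S V ∧
      ∃ (ι : X ⟶ K₁) (g : K₁ ⟶ K₂) (h : K₂ ⟶ (X⟦(1 : ℤ)⟧)),
        (Triangle.mk ι g h ∈ distTriang C) ∧
        (∀ L ∈ Kcl C S V, ∀ f : X ⟶ L, ∃ t : K₁ ⟶ L, ι ≫ t = f) := by
  obtain ⟨K, hK, ι, hι⟩ := hff.1 X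
  obtain ⟨Z, q, h, hT⟩ := distinguished_cocone_triangle ι
  exact ⟨K, Z, hK, hP.cone_mem_Kcl hK hT hι, ι, q, h, hT, hι⟩

end PaperFormalization
end

section
/- Let C be a triangulated category equipped with a cotorsion pair (S,V) such that K := add(S*V) is functorially finite in C, and let X →f Y →g Z →h X[1] be a distinguished triangle in C. Then ϖ(f) is an epimorphism in the additive quotient C/K if and only if g : Y → Z factors through an object of K. -/
universe w v u v₂ u₂

open CategoryTheory Category Limits Pretriangulated

namespace PaperFormalization

variable (C : Type u) [Category.{v} C] [Preadditive C] [HasZeroObject C]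
  [HasShift C ℤ] [∀ n : ℤ, (shiftFunctor C n).Additive] [Pretriangulated C]
  [IsTriangulated C] [HasBinaryBiproducts C]

variable {C}

set_option linter.unusedSectionVars false

/-- A morphism out of the first object of a distinguished triangle extends to the second object
as soon as its shift is killed by the third morphism. -/
theorem exists_extension {T : Triangle C} (hT : T ∈ distTriang C) {W : C} (a : T.obj₁ ⟶ W)
    (ha : T.mor₃ ≫ a⟦(1 : ℤ)⟧' = 0) : ∃ b : T.obj₂ ⟶ W, a = T.mor₁ ≫ b := by
  obtain ⟨b, hb, -⟩ := complete_distinguished_triangle_morphism₂ T _ hT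
    (contractible_distinguished W) a 0 (ha.trans zero_comp.symm)
  exact ⟨b, (hb.trans (Category.comp_id a)).symm⟩

/-- The middle morphism of a morphism of distinguished triangles, with unbundled triangles. -/
theorem exists_middle_morphism {X Y Z X' Y' Z' : C} {f : X ⟶ Y} {g : Y ⟶ Z}
    {h : Z ⟶ X⟦(1 : ℤ)⟧} {f' : X' ⟶ Y'} {g' : Y' ⟶ Z'} {h' : Z' ⟶ X'⟦(1 : ℤ)⟧}
    (hT : Triangle.mk f g h ∈ distTriang C) (hT' : Triangle.mk f' g' h' ∈ distTriang C)
    (a : X ⟶ X') (c : Z ⟶ Z') (hc : h ≫ a⟦(1 : ℤ)⟧' = c ≫ h') :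
    ∃ b : Y ⟶ Y', f ≫ b = a ≫ f' ∧ g ≫ c = b ≫ g' :=
  complete_distinguished_triangle_morphism₂ _ _ hT hT' a c hc

/-- Every composite `A ⟶ X ⟶ Y ⟶ B⟦1⟧` through `f` with `A⟦1⟧ ∈ S` and `B ∈ V` is zero. -/
def VanishesBetween (S V : Set C) {X Y : C} (f : X ⟶ Y) : Prop :=
  ∀ ⦃A B : C⦄, A⟦(1 : ℤ)⟧ ∈ S → B ∈ V → ∀ (s : A ⟶ X) (w : Y ⟶ B⟦(1 : ℤ)⟧), s ≫ f ≫ w = 0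

namespace IsTriCotorsionPairOn

variable {S V : Set C}

theorem hom_eq_zero {N : Set C} (hP : IsTriCotorsionPairOn C N S V) {A B : C}
    (hA : A⟦(1 : ℤ)⟧ ∈ S) (hB : B ∈ V) (f : A ⟶ B) : f = 0 :=
  (shiftFunctor C (1 : ℤ)).map_injective (by rw [Functor.map_zero]; exact hP.orth hA hB _)

theorem exists_distinguished_left (hP : IsTriCotorsionPair C S V) (X : C) :
    ∃ (A B : C), A⟦(1 : ℤ)⟧ ∈ S ∧ B ∈ V ∧
      ∃ (s : A ⟶ X) (i : X ⟶ B) (k : B ⟶ A⟦(1 : ℤ)⟧), Triangle.mk s i k ∈ distTriang C := by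
  obtain ⟨B, S', hB, hS', f, g, h, hT⟩ := hP.coresolve X (Set.mem_univ X)
  exact ⟨S'⟦(-1 : ℤ)⟧, B, hP.S_iso ((shiftEquiv C (1 : ℤ)).counitIso.app S').symm hS', hB,
    _, _, _, inv_rot_of_distTriang _ hT⟩

end IsTriCotorsionPairOn

namespace VanishesBetween

variable {S V : Set C}

theorem sub {X Y : C} {f g : X ⟶ Y} (hf : VanishesBetween S V f) (hg : VanishesBetween S V g) :
    VanishesBetween S V (f - g) := fun A B hA hB s w => by
  rw [Preadditive.sub_comp, Preadditive.comp_sub, hf hA hB, hg hA hB, sub_zero]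

theorem comp_left {X Y Z : C} {f : Y ⟶ Z} (hf : VanishesBetween S V f) (u : X ⟶ Y) :
    VanishesBetween S V (u ≫ f) := fun A B hA hB s w => by
  simpa using hf hA hB (s ≫ u) w

theorem comp_right {X Y Z : C} {f : X ⟶ Y} (hf : VanishesBetween S V f) (u : Y ⟶ Z) :
    VanishesBetween S V (f ≫ u) := fun A B hA hB s w => by
  simpa using hf hA hB s (u ≫ w)

theorem zero (X Y : C) : VanishesBetween S V (0 : X ⟶ Y) := fun A B hA hB s w => by simp

theorem id_of_mem_Kcl {N : Set C} (hP : IsTriCotorsionPairOn C N S V) {X : C}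
    (hX : X ∈ Kcl C S V) : VanishesBetween S V (𝟙 X) := by
  change addMem C (SstarV C S V) X at hX
  induction hX with
  | of hX =>
    obtain ⟨S', V', hS', hV', f, g, h, hT⟩ := hX
    intro A B hA hB s w
    obtain ⟨t, rfl⟩ : ∃ t, s = t ≫ f :=
      Triangle.coyoneda_exact₂ _ hT s (hP.hom_eq_zero hA hV' _)
    simp [hP.orth hS' hB (f ≫ w)]
  | iso e _ ih => simpa using (ih.comp_left e.inv).comp_right e.hom
  | sum _ _ ih₁ ih₂ =>
    have h := ((ih₁.comp_left biprod.fst).comp_right biprod.inl).sub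
      ((zero _ _).sub ((ih₂.comp_left biprod.snd).comp_right biprod.inr))
    simpa [biprod.total] using h
  | summand _ h ih =>
    obtain ⟨i, p, hip⟩ := h
    simpa [hip] using (ih.comp_left i).comp_right p

/-- For a cotorsion pair `(S, V)`, vanishing between `S` and `V` is the same as factoring through
`add (S * V)`. -/
theorem iff_factorsThruSet (hP : IsTriCotorsionPair C S V) {X Y : C} (f : X ⟶ Y) :
    VanishesBetween S V f ↔ FactorsThruSet C (Kcl C S V) f := by
  constructor
  · intro hf
    obtain ⟨A, B, hA, hB, s, i, k, hT⟩ := hP.exists_distinguished_left X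
    obtain ⟨B', S', hB', hS', q, p, w, hT'⟩ := hP.resolve Y (Set.mem_univ Y)
    obtain ⟨l, hl⟩ : ∃ l, s ≫ f = l ≫ p :=
      Triangle.coyoneda_exact₃ _ hT' (s ≫ f) ((Category.assoc s f w).trans (hf hA hB' s w))
    obtain ⟨P, j, r, hP'⟩ := distinguished_cocone_triangle₂ (k ≫ l⟦(1 : ℤ)⟧')
    obtain ⟨x, hx₁, hx₂⟩ := exists_middle_morphism hT hP' l (𝟙 B) (Category.id_comp _).symm
    obtain ⟨y, hy⟩ : ∃ y : P ⟶ Y, p = j ≫ y := by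
      refine exists_extension hP' p ?_
      have hk : k ≫ s⟦(1 : ℤ)⟧' = 0 := comp_distTriang_mor_zero₃₁ _ hT
      change (k ≫ l⟦(1 : ℤ)⟧') ≫ p⟦(1 : ℤ)⟧' = 0
      rw [Category.assoc, ← Functor.map_comp, ← hl, Functor.map_comp, reassoc_of% hk, zero_comp]
    rw [Category.comp_id] at hx₂
    obtain ⟨n, hn⟩ : ∃ n : B ⟶ Y, f - x ≫ y = i ≫ n := by
      refine Triangle.yoneda_exact₂ _ hT _ ?_
      change s ≫ (f - x ≫ y) = 0
      rw [Preadditive.comp_sub, ← Category.assoc s x y, hx₁, Category.assoc, ← hy, hl, sub_self]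
    refine ⟨P, .of ⟨S', B, hS', hB, j, r, _, hP'⟩, x, y + r ≫ n, ?_⟩
    rw [Preadditive.comp_add, ← Category.assoc x r n, ← hx₂, ← hn]
    abel
  · rintro ⟨Z, hZ, a, b, rfl⟩
    simpa using ((id_of_mem_Kcl hP hZ).comp_left a).comp_right b

/-- Vanishing descends along `f` in a distinguished triangle whose second morphism vanishes. -/
theorem of_distinguished (hP : IsTriCotorsionPair C S V) {X Y Z W : C} {f : X ⟶ Y} {g : Y ⟶ Z}
    {h : Z ⟶ X⟦(1 : ℤ)⟧} (hT : Triangle.mk f g h ∈ distTriang C) (hg : VanishesBetween S V g)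
    {u : Y ⟶ W} (hu : VanishesBetween S V (f ≫ u)) : VanishesBetween S V u := by
  intro A B hA hB s w
  obtain ⟨B', S', hB', hS', _, p, v, hZ⟩ := hP.resolve Z (Set.mem_univ Z)
  obtain ⟨t, ht⟩ : ∃ t, s ≫ g = t ≫ p :=
    Triangle.coyoneda_exact₃ _ hZ (s ≫ g) ((Category.assoc s g v).trans (hg hA hB' s v))
  obtain ⟨A', D, hA', hD, a, i, k, hX⟩ := hP.exists_distinguished_left X
  obtain ⟨d, hd⟩ : ∃ d, f ≫ u ≫ w = i ≫ d :=
    Triangle.yoneda_exact₂ _ hX (f ≫ u ≫ w) ((congrArg (a ≫ ·) (Category.assoc f u w).symm).trans (hu hA' hB a w))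
  obtain ⟨Q, j, q, hQ⟩ := distinguished_cocone_triangle₂ (p ≫ h)
  obtain ⟨φ, hφ₁, hφ₂⟩ := exists_middle_morphism hQ hT (𝟙 X) p (by simp)
  rw [Category.id_comp] at hφ₁
  obtain ⟨e, he⟩ : ∃ e : Q ⟶ D, i = j ≫ e :=
    exists_extension hQ i (hP.orth hS' hD _)
  obtain ⟨r, hr⟩ : ∃ r : S' ⟶ B⟦(1 : ℤ)⟧, φ ≫ u ≫ w - e ≫ d = q ≫ r := by
    refine Triangle.yoneda_exact₂ _ hQ _ ?_
    change j ≫ (φ ≫ u ≫ w - e ≫ d) = 0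
    rw [Preadditive.comp_sub, reassoc_of% hφ₁, hd, he, Category.assoc, sub_self]
  have hφ : φ ≫ u ≫ w = e ≫ d := by
    rw [← sub_eq_zero, hr, hP.orth hS' hB r, comp_zero]
  obtain ⟨s', hs'⟩ : ∃ s' : A ⟶ Q, t = s' ≫ q := by
    refine Triangle.coyoneda_exact₃ _ hQ t ?_
    change t ≫ p ≫ h = 0
    have hgh : g ≫ h = 0 := comp_distTriang_mor_zero₂₃ _ hT
    rw [← reassoc_of% ht, hgh, comp_zero]
  obtain ⟨m, hm⟩ : ∃ m : A ⟶ X, s - s' ≫ φ = m ≫ f := by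
    refine Triangle.coyoneda_exact₂ _ hT _ ?_
    change (s - s' ≫ φ) ≫ g = 0
    rw [Preadditive.sub_comp, Category.assoc, ← hφ₂, ht, hs', Category.assoc, sub_self]
  rw [eq_add_of_sub_eq hm, Preadditive.add_comp, Category.assoc, Category.assoc, hφ,
    ← Category.assoc s' e d, hP.hom_eq_zero hA hD (s' ≫ e), zero_comp, add_zero]
  simpa using hu hA hB m w

end VanishesBetween

theorem congruence_Krel {S V : Set C} (hP : IsTriCotorsionPair C S V) :
    Congruence (Krel C S V) := by
  have key : ∀ {X Y : C} (f g : X ⟶ Y), Krel C S V f g ↔ VanishesBetween S V (f - g) :=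
    fun f g => (VanishesBetween.iff_factorsThruSet hP (f - g)).symm
  refine
    { equivalence := ⟨fun f => ?_, fun {f g} h => ?_, fun {f g k} h h' => ?_⟩
      comp_left := fun u f g h => ?_
      comp_right := fun u h => ?_ }
  · rw [key] at h ⊢
    rw [← Preadditive.comp_sub]
    exact h.comp_left u
  · rw [key] at h ⊢
    rw [← Preadditive.sub_comp]
    exact h.comp_right u
  · rw [key, sub_self]
    exact .zero _ _
  · rw [key] at h ⊢
    simpa using (VanishesBetween.zero _ _).sub h
  · rw [key] at h h' ⊢
    simpa using h.sub ((VanishesBetween.zero _ _).sub h')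

theorem Kproj_map_eq_iff {S V : Set C} (hP : IsTriCotorsionPair C S V) {X Y : C} (f g : X ⟶ Y) :
    (Kproj C S V).map f = (Kproj C S V).map g ↔ VanishesBetween S V (f - g) := by
  have := congruence_Krel hP
  rw [CategoryTheory.Quotient.functor_map_eq_iff]
  exact (VanishesBetween.iff_factorsThruSet hP (f - g)).symm

variable (C)

/-- If `K = add (S * V)` is functorially finite and
`X →f Y →g Z →h X⟦1⟧` is a distinguished triangle, then `ϖ(f)` is an epimorphism
in `C/K` iff `g` factors through an object of `K`. -/
theorem statement15 (S V : Set C) (hP : IsTriCotorsionPair C S V)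
    (hff : FunctoriallyFinite C (Kcl C S V))
    {X Y Z : C} (f : X ⟶ Y) (g : Y ⟶ Z) (h : Z ⟶ (X⟦(1 : ℤ)⟧))
    (hT : Triangle.mk f g h ∈ distTriang C) :
    Epi ((Kproj C S V).map f) ↔ FactorsThruSet C (Kcl C S V) g := by
  rw [← VanishesBetween.iff_factorsThruSet hP]
  constructor
  · intro _
    have hfg : f ≫ g = 0 := comp_distTriang_mor_zero₁₂ _ hT
    have hg : (Kproj C S V).map g = (Kproj C S V).map 0 := by
      rw [← cancel_epi ((Kproj C S V).map f), ← Functor.map_comp, ← Functor.map_comp, hfg,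
        comp_zero]
    simpa using (Kproj_map_eq_iff hP g 0).1 hg
  · refine fun hg => ⟨fun {W} a b hab => ?_⟩
    obtain ⟨W⟩ := W
    obtain ⟨u, rfl⟩ := (Kproj C S V).map_surjective (X := Y) (Y := W) a
    obtain ⟨v, rfl⟩ := (Kproj C S V).map_surjective (X := Y) (Y := W) b
    rw [← Functor.map_comp, ← Functor.map_comp, Kproj_map_eq_iff hP, ← Preadditive.comp_sub] at hab
    exact (Kproj_map_eq_iff hP u v).2 (.of_distinguished hP hT hg hab)

end PaperFormalization
end
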